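/- Let L be a complete residuated lattice satisfying the double negation law, and define n(a) := ⨆{x ∈ L | a ⊙ x = 0}. Then the residuated-lattice operations are recovered from the semiring (L, ∨, ⊙, 0, 1): for all a, b ∈ L one has n(n(a) ∨ n(b)) = a ∧ b and n(a ⊙ n(b)) = a → b. -/

import Mathlib

/-- A complete residuated lattice: a complete lattice (with `⊥` playing the role of
`0` and `⊤` the role of `1`) together with a commutative monoid operation `mul` with
unit `⊤` satisfying the adjointness property. -/
class CompleteResiduatedLattice (L : Type*) extends CompleteLattice L where
  mul : L → L → L
  mul_assoc : ∀ x y z : L, mul (mul x y) z = mul x (mul y z)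
  mul_comm : ∀ x y : L, mul x y = mul y x
  mul_top : ∀ x : L, mul x ⊤ = x
  himp : L → L → L
  adjoint : ∀ x y z : L, mul x y ≤ z ↔ x ≤ himp y z

open CompleteResiduatedLattice

/-- `n a := ⨆ {x | a ⊙ x = 0}`. -/
def nres {L : Type*} [CompleteResiduatedLattice L] (a : L) : L :=
  sSup {x : L | mul a x = ⊥}

namespace CompleteResiduatedLattice

variable {L : Type*} [CompleteResiduatedLattice L]

theorem nres_eq_himp_bot (a : L) : nres a = himp a ⊥ := by
  apply le_antisymm
  · refine sSup_le fun x hx => ?_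
    rw [← adjoint, mul_comm]
    exact le_of_eq hx
  · refine le_sSup ?_
    rw [Set.mem_ofPred_eq, ← le_bot_iff, mul_comm, adjoint]

theorem le_himp_bot_comm {x y : L} : x ≤ himp y ⊥ ↔ y ≤ himp x ⊥ := by
  rw [← adjoint, ← adjoint, mul_comm]

end CompleteResiduatedLattice

/-- For a complete residuated lattice satisfying the double negation law, the
residuated-lattice operations are recovered from the semiring reduct via
`n(a) := ⨆ {x | a ⊙ x = 0}`: `n(n(a) ∨ n(b)) = a ∧ b` and `n(a ⊙ n(b)) = a → b`. -/
theorem stmt_13 {L : Type*} [CompleteResiduatedLattice L]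
    (hdnl : ∀ x : L, himp (himp x ⊥) ⊥ = x) :
    ∀ a b : L, nres (nres a ⊔ nres b) = a ⊓ b ∧ nres (mul a (nres b)) = himp a b := by
  intro a b
  simp only [nres_eq_himp_bot]
  constructor
  · refine eq_of_forall_le_iff fun x => ?_
    rw [le_himp_bot_comm, sup_le_iff, le_himp_bot_comm, le_himp_bot_comm (x := himp b ⊥),
      hdnl, hdnl, le_inf_iff]
  · refine eq_of_forall_le_iff fun x => ?_
    rw [← adjoint, ← CompleteResiduatedLattice.mul_assoc, adjoint, hdnl, adjoint]
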